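/- arXiv:1007.3239 — 6 statements merged into one kernel-verified Lean document; each statement's English description precedes it below -/
import Mathlib

section
/- Let B(n) be the number of n×n bisymmetric permutation matrices. Then B(1) = 1, B(2) = 2, B(4) = 6, B(n) = B(n−1) for every odd n ≥ 3, and B(n) = 2·B(n−2) + (n−2)·B(n−4) for every even n ≥ 6. -/
open Matrix

/-- The `n × n` reverse matrix `J`: (1-indexed) `J i j = 1` iff `i + j = n + 1`. -/
def revMat (n : ℕ) : Matrix (Fin n) (Fin n) ℝ :=
  Matrix.of fun i j => if (i : ℕ) + (j : ℕ) + 1 = n then 1 else 0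

/-- The `n × n` all-ones matrix `E`. -/
def allOnes (n : ℕ) : Matrix (Fin n) (Fin n) ℝ :=
  Matrix.of fun _ _ => 1

/-- `A` is a magic square with magic number `μ`: all rows, all columns, the main
diagonal and the minor diagonal sum to `μ`. -/
def IsMagic {n : ℕ} (A : Matrix (Fin n) (Fin n) ℝ) (μ : ℝ) : Prop :=
  (∀ i, ∑ j, A i j = μ) ∧ (∀ j, ∑ i, A i j = μ) ∧
    A.trace = μ ∧ (revMat n * A).trace = μ

/-- `A` is a semi-magic square with magic number `μ`: all rows and columns sum to `μ`. -/
def IsSemiMagic {n : ℕ} (A : Matrix (Fin n) (Fin n) ℝ) (μ : ℝ) : Prop :=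
  (∀ i, ∑ j, A i j = μ) ∧ (∀ j, ∑ i, A i j = μ)

/-- `P` is a permutation matrix: a 0–1 matrix with exactly one 1 in each row and column. -/
def IsPermMat {n : ℕ} (P : Matrix (Fin n) (Fin n) ℝ) : Prop :=
  (∀ i j, P i j = 0 ∨ P i j = 1) ∧ (∀ i, ∃! j, P i j = 1) ∧ (∀ j, ∃! i, P i j = 1)

/-- A square matrix is bisymmetric if it is symmetric and persymmetric. -/
def IsBisym {n : ℕ} (P : Matrix (Fin n) (Fin n) ℝ) : Prop :=
  P = Pᵀ ∧ revMat n * P = (revMat n * P)ᵀ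

/-- A square matrix is 90°-symmetric if `Pᵀ = J * P`. -/
def IsRot90 {n : ℕ} (P : Matrix (Fin n) (Fin n) ℝ) : Prop :=
  Pᵀ = revMat n * P

/-- A magic classifying permutation matrix (MCPM): a symmetric permutation matrix with
trace 0 when `n` is even; when `n` is odd, the middle diagonal entry is 1 and the trace is 1. -/
def IsMCPM {n : ℕ} (P : Matrix (Fin n) (Fin n) ℝ) : Prop :=
  IsPermMat P ∧ P = Pᵀ ∧
    ((Even n ∧ P.trace = 0) ∨
      (Odd n ∧ P.trace = 1 ∧ ∀ i : Fin n, (i : ℕ) = n / 2 → P i i = 1))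

/-- `A` is a natural magic square matrix: its entries are a rearrangement of `1, …, n²`. -/
def IsNatural {n : ℕ} (A : Matrix (Fin n) (Fin n) ℝ) : Prop :=
  Function.Injective (fun p : Fin n × Fin n => A p.1 p.2) ∧
    ∀ i j, ∃ k : Fin (n * n), A i j = (k : ℝ) + 1

open Function in
/-- The involutions of `α` commuting with `r`. -/
def CommInvol {α : Type*} (r : α → α) : Set (α → α) :=
  {f | Involutive f ∧ ∀ x, f (r x) = r (f x)}

/-- The points outside the `r`-orbits of `a` and `b`. -/
abbrev OffOrbits {α : Type*} (r : α → α) (a b : α) : Type _ :=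
  {c : α // c ≠ a ∧ c ≠ b ∧ c ≠ r a ∧ c ≠ r b}

/-- An involution `r` restricted to the points outside the orbits of `a` and `b`. -/
def restrictOff {α : Type*} {r : α → α} (hr : Function.Involutive r) (a b : α) :
    OffOrbits r a b → OffOrbits r a b :=
  fun c => ⟨r c, by
    obtain ⟨c, h⟩ := c
    have := hr c
    have := hr a
    have := hr b
    grind⟩

/-- Extension of a map defined off the orbits of `a` and `b` by `a ↔ b`, `r a ↔ r b`. -/
def extendOff {α : Type*} [DecidableEq α] (r : α → α) (a b : α)
    (g : OffOrbits r a b → OffOrbits r a b) (c : α) : α :=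
  if h : c ≠ a ∧ c ≠ b ∧ c ≠ r a ∧ c ≠ r b then g ⟨c, h⟩
  else if c = a then b else if c = b then a else if c = r a then r b else r a

lemma extendOff_mem {α : Type*} [DecidableEq α] {r : α → α} (hr : Function.Involutive r)
    {a b : α} (hab : r a = a ↔ r b = b) {g : OffOrbits r a b → OffOrbits r a b}
    (hg : g ∈ CommInvol (restrictOff hr a b)) : extendOff r a b g ∈ CommInvol r := by
  have ha := hr a
  have hb := hr b
  obtain ⟨hg1, hg2⟩ := hg
  refine ⟨fun c => ?_, fun c => ?_⟩
  · by_cases h : c ≠ a ∧ c ≠ b ∧ c ≠ r a ∧ c ≠ r b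
    · have h1 : extendOff r a b g c = g ⟨c, h⟩ := dif_pos h
      rw [h1]
      have h2 : extendOff r a b g (g ⟨c, h⟩ : α) = g (g ⟨c, h⟩) := dif_pos (g ⟨c, h⟩).2
      rw [h2, hg1]
    · unfold extendOff
      grind
  · have hc := hr c
    by_cases h : c ≠ a ∧ c ≠ b ∧ c ≠ r a ∧ c ≠ r b
    · have h1 : extendOff r a b g c = g ⟨c, h⟩ := dif_pos h
      have h2 : extendOff r a b g (r c) = g (restrictOff hr a b ⟨c, h⟩) :=
        dif_pos (restrictOff hr a b ⟨c, h⟩).2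
      rw [h1, h2, hg2]
      rfl
    · unfold extendOff
      grind

/-- The elements of `CommInvol r` sending `a` to `b` are determined by their restriction. -/
def fiberEquiv {α : Type*} [DecidableEq α] {r : α → α} (hr : Function.Involutive r)
    {a b : α} (hab : r a = a ↔ r b = b) :
    {f : CommInvol r // f.1 a = b} ≃ CommInvol (restrictOff hr a b) where
  toFun f := ⟨fun c => ⟨f.1.1 c, by
    obtain ⟨⟨f, hf1, hf2⟩, hf⟩ := f
    obtain ⟨c, hc⟩ := c
    have := hf1 c
    have := hf1 a
    have := hf2 a
    have := hf2 b
    grind⟩, fun c => Subtype.ext (f.1.2.1 c), fun c => Subtype.ext (f.1.2.2 c)⟩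
  invFun g := ⟨⟨extendOff r a b g.1, extendOff_mem hr hab g.2⟩, by simp [extendOff]⟩
  left_inv f := by
    obtain ⟨⟨f, hf1, hf2⟩, hf⟩ := f
    ext c
    have := hf1 a
    have := hf2 a
    have := hf2 b
    simp only [extendOff]
    grind
  right_inv g := by
    ext c
    exact (dif_pos c.2 : extendOff r a b g.1 c = g.1 c)

lemma restrictOff_involutive {α : Type*} {r : α → α} (hr : Function.Involutive r) (a b : α) :
    Function.Involutive (restrictOff hr a b) := fun c => Subtype.ext (hr c)

lemma card_offOrbits {α : Type*} [Fintype α] [DecidableEq α] (r : α → α) (a b : α) :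
    Nat.card (OffOrbits r a b) = Fintype.card α - ({a, b, r a, r b} : Finset α).card := by
  rw [← Finset.card_compl, Nat.card_eq_fintype_card, Fintype.card_subtype]
  congr 1
  ext c
  simp

lemma card_commInvol_eq_sum {α : Type*} [Fintype α] [DecidableEq α] {r : α → α} (a : α) :
    Nat.card (CommInvol r) = ∑ b, Nat.card {f : CommInvol r // f.1 a = b} := by
  rw [← Nat.card_sigma]
  exact Nat.card_congr (Equiv.sigmaFiberEquiv fun f : CommInvol r => f.1 a).symm

/-- The number of involutions in the hyperoctahedral group of rank `m`. -/
def hyperoctInvol : ℕ → ℕ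
  | 0 => 1
  | 1 => 2
  | m + 2 => 2 * hyperoctInvol (m + 1) + (2 * m + 2) * hyperoctInvol m

lemma card_commInvol_of_fixedPointFree (m : ℕ) : ∀ {α : Type} [Fintype α] {r : α → α},
    Function.Involutive r → (∀ x, r x ≠ x) → Fintype.card α = 2 * m →
    Nat.card (CommInvol r) = hyperoctInvol m := by
  induction m using Nat.strong_induction_on with
  | _ m ih =>
  intro α _ r hr hfix hcard
  classical
  rcases Nat.eq_zero_or_pos m with rfl | hm
  · have : IsEmpty α := Fintype.card_eq_zero_iff.1 (by simpa using hcard)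
    have h : CommInvol r = Set.univ :=
      Set.eq_univ_of_forall fun f => ⟨fun x => isEmptyElim x, fun x => isEmptyElim x⟩
    rw [h]
    simp [hyperoctInvol]
  have : Nonempty α := Fintype.card_pos_iff.1 (by omega)
  obtain ⟨a⟩ := this
  have hfiber (b : α) : Nat.card {f : CommInvol r // f.1 a = b} =
      if b ∈ ({a, r a} : Finset α) then hyperoctInvol (m - 1) else hyperoctInvol (m - 2) := by
    have ha := hr a
    have hb := hr b
    have ha' := hfix a
    have hb' := hfix b
    rw [Nat.card_congr (fiberEquiv hr (a := a) (b := b) (by simp [hfix]))]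
    have hoff := card_offOrbits r a b
    rw [Nat.card_eq_fintype_card] at hoff
    have hfix' : ∀ c, restrictOff hr a b c ≠ c := fun c h => hfix c (congrArg Subtype.val h)
    split_ifs with h
    · have hset : ({a, b, r a, r b} : Finset α) = {a, r a} := by
        ext c
        simp only [Finset.mem_insert, Finset.mem_singleton] at h ⊢
        grind
      rw [hset, Finset.card_pair ha'.symm] at hoff
      exact ih _ (by omega) (restrictOff_involutive hr a b) hfix' (by omega)
    · simp only [Finset.mem_insert, Finset.mem_singleton, not_or] at h
      have h4 : ({a, b, r a, r b} : Finset α).card = 4 := by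
        rw [Finset.card_insert_of_notMem, Finset.card_insert_of_notMem, Finset.card_pair] <;>
          grind
      have := Finset.card_le_univ ({a, b, r a, r b} : Finset α)
      exact ih _ (by omega) (restrictOff_involutive hr a b) hfix' (by omega)
  rw [card_commInvol_eq_sum a, Finset.sum_congr rfl fun b _ => hfiber b, Finset.sum_ite,
    Finset.sum_const, Finset.sum_const, Finset.filter_mem_eq_inter, Finset.univ_inter,
    Finset.filter_notMem_eq_sdiff, ← Finset.compl_eq_univ_sdiff, Finset.card_compl,
    Finset.card_pair (hfix a).symm, hcard]
  match m, hm with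
  | 1, _ => simp [hyperoctInvol]
  | k + 2, _ => simp [hyperoctInvol]; left; omega

lemma card_commInvol_of_unique_fixedPoint {m : ℕ} {α : Type} [Fintype α] {r : α → α}
    (hr : Function.Involutive r) (a : α) (ha : ∀ x, r x = x ↔ x = a)
    (hcard : Fintype.card α = 2 * m + 1) : Nat.card (CommInvol r) = hyperoctInvol m := by
  classical
  have hra : r a = a := (ha a).2 rfl
  have hall : ∀ f : CommInvol r, f.1 a = a := fun f => (ha _).1 (by rw [← f.2.2, hra])
  rw [← Nat.card_congr (Equiv.subtypeUnivEquiv hall), Nat.card_congr (fiberEquiv hr Iff.rfl)]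
  have hoff := card_offOrbits r a a
  rw [Nat.card_eq_fintype_card] at hoff
  refine card_commInvol_of_fixedPointFree m (restrictOff_involutive hr a a)
    (fun c h => c.2.1 ((ha c).1 (congrArg Subtype.val h))) ?_
  rw [hoff, hcard]
  simp [hra]

lemma card_commInvol_rev (n : ℕ) :
    Nat.card (CommInvol (Fin.rev : Fin n → Fin n)) = hyperoctInvol (n / 2) := by
  rcases Nat.even_or_odd' n with ⟨m, rfl | rfl⟩
  · rw [card_commInvol_of_fixedPointFree m Fin.rev_involutive _ (by simp)]
    · congr 1; omega
    · intro x h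
      have := congrArg Fin.val h
      rw [Fin.val_rev] at this
      omega
  · rw [card_commInvol_of_unique_fixedPoint (m := m) Fin.rev_involutive ⟨m, by omega⟩ _ (by simp)]
    · congr 1; omega
    · intro x
      rw [Fin.ext_iff, Fin.ext_iff, Fin.val_rev]
      dsimp only
      omega

/-- The 0–1 matrix of the graph of a function. -/
def graphMat {n : ℕ} (f : Fin n → Fin n) : Matrix (Fin n) (Fin n) ℝ :=
  Matrix.of fun i j => if f i = j then 1 else 0

lemma graphMat_eq_one_iff {n : ℕ} {f : Fin n → Fin n} {i j : Fin n} :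
    graphMat f i j = 1 ↔ f i = j := by
  simp [graphMat]

lemma graphMat_injective {n : ℕ} : Function.Injective (graphMat (n := n)) := fun f g h =>
  funext fun i => (graphMat_eq_one_iff.1 (h ▸ graphMat_eq_one_iff.2 rfl : graphMat g i (f i) = 1)).symm

lemma revMat_mul_apply {n : ℕ} (P : Matrix (Fin n) (Fin n) ℝ) (i j : Fin n) :
    (revMat n * P) i j = P i.rev j := by
  have h (k : Fin n) : revMat n i k = if k = i.rev then 1 else 0 := by
    simp only [revMat, Matrix.of_apply, Fin.ext_iff, Fin.val_rev]
    congr 1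
    apply propext
    omega
  simp [Matrix.mul_apply, h]

lemma setOf_bisymmetric_perm (n : ℕ) :
    {P : Matrix (Fin n) (Fin n) ℝ | IsPermMat P ∧ IsBisym P} =
      graphMat '' CommInvol (Fin.rev : Fin n → Fin n) := by
  ext P
  constructor
  · rintro ⟨⟨h01, hrow, -⟩, hsymm, hpersymm⟩
    choose f hf hf' using hrow
    beta_reduce at hf hf'
    have hP : P = graphMat f := by
      ext i j
      by_cases h : f i = j
      · rw [graphMat_eq_one_iff.2 h, ← h, hf]
      · have h1 : P i j ≠ 1 := fun h1 => h (hf' i j h1).symm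
        simp [graphMat, h, (h01 i j).resolve_right h1]
    have hsymm' (i j) : P i j = P j i := congrFun (congrFun hsymm i) j
    have hpersymm' (i j : Fin n) : P i.rev j = P j.rev i := by
      have := congrFun (congrFun hpersymm i) j
      rwa [Matrix.transpose_apply, revMat_mul_apply, revMat_mul_apply] at this
    refine ⟨f, ⟨fun i => ?_, fun i => ?_⟩, hP.symm⟩
    · exact (hf' (f i) i (by rw [hsymm', hf])).symm
    · refine (hf' _ _ ?_).symm
      rw [hpersymm', Fin.rev_rev, hsymm', hf]
  · rintro ⟨f, ⟨hf, hrev⟩, rfl⟩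
    have hsymm (i j) : f i = j ↔ f j = i := hf.eq_iff.trans eq_comm
    refine ⟨⟨fun i j => ?_, fun i => ?_, fun j => ?_⟩, ?_, ?_⟩
    · simp only [graphMat, Matrix.of_apply]
      split_ifs <;> simp
    · simp [graphMat_eq_one_iff]
    · simp only [graphMat_eq_one_iff, hsymm _ j]
      simp
    · ext i j
      simp only [graphMat, Matrix.transpose_apply, Matrix.of_apply, hsymm i j]
    · ext i j
      simp only [Matrix.transpose_apply, revMat_mul_apply, graphMat, Matrix.of_apply, hrev,
        Fin.rev_eq_iff]
      simp only [hsymm i j.rev, hrev, Fin.rev_eq_iff]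

/-- the count of bisymmetric permutation matrices. -/
theorem count_bisymmetric_perm (B : ℕ → ℕ)
    (hB : ∀ n, B n = Set.ncard {P : Matrix (Fin n) (Fin n) ℝ | IsPermMat P ∧ IsBisym P}) :
    B 1 = 1 ∧ B 2 = 2 ∧ B 4 = 6 ∧
    (∀ n, 3 ≤ n → Odd n → B n = B (n - 1)) ∧
    (∀ n, 6 ≤ n → Even n → B n = 2 * B (n - 2) + (n - 2) * B (n - 4)) := by
  have hcount (n : ℕ) : B n = hyperoctInvol (n / 2) := by
    rw [hB, setOf_bisymmetric_perm, Set.ncard_image_of_injective _ graphMat_injective,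
      ← card_commInvol_rev, Nat.card_coe_set_eq]
  simp only [hcount]
  refine ⟨rfl, rfl, rfl, ?_, ?_⟩
  · rintro n hn ⟨k, rfl⟩
    congr 1
    omega
  · rintro n hn ⟨k, rfl⟩
    obtain ⟨m, rfl⟩ : ∃ m, k = m + 2 := ⟨k - 2, by omega⟩
    have h0 : (m + 2 + (m + 2)) / 2 = m + 2 := by omega
    have h1 : (m + 2 + (m + 2) - 2) / 2 = m + 1 := by omega
    have h2 : (m + 2 + (m + 2) - 4) / 2 = m := by omega
    have h3 : m + 2 + (m + 2) - 2 = 2 * m + 2 := by omega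
    rw [h0, h1, h2, h3, hyperoctInvol]
end

section
/- If A is an n×n real magic square with magic number μ and P is an n×n bisymmetric permutation matrix, then P·A·P is a magic square with magic number μ. -/
open Matrix

/-- The row sums of a permutation matrix are `1`. -/
theorem IsPermMat.mulVec_one {n : ℕ} {P : Matrix (Fin n) (Fin n) ℝ} (hP : IsPermMat P) :
    P *ᵥ 1 = 1 := by
  ext i
  obtain ⟨j, hj, hu⟩ := hP.2.1 i
  rw [mulVec, dotProduct_one, Finset.sum_eq_single j]
  · exact hj
  · exact fun k _ hk => (hP.1 i k).resolve_right fun h => hk (hu k h)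
  · simp

/-- A permutation matrix is orthogonal. -/
theorem IsPermMat.mul_transpose {n : ℕ} {P : Matrix (Fin n) (Fin n) ℝ} (hP : IsPermMat P) :
    P * Pᵀ = 1 := by
  ext i k
  obtain ⟨j, hj, hu⟩ := hP.2.1 i
  rw [mul_apply, Finset.sum_eq_single j]
  · rw [transpose_apply, hj, one_mul, one_apply]
    split_ifs with h
    · exact h ▸ hj
    · exact (hP.1 k j).resolve_right fun hk => h ((hP.2.2 j).unique hj hk)
  · intro m _ hm
    rw [(hP.1 i m).resolve_right fun h => hm (hu m h), zero_mul]
  · simp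

theorem revMat_transpose (n : ℕ) : (revMat n)ᵀ = revMat n := by
  ext i j
  simp [revMat, add_comm (i : ℕ) j]

/-- Rows and columns of a square matrix sum to `μ` iff the all-ones vector is a left and right
eigenvector with eigenvalue `μ`. -/
theorem isSemiMagic_iff {n : ℕ} {A : Matrix (Fin n) (Fin n) ℝ} {μ : ℝ} :
    IsSemiMagic A μ ↔ A *ᵥ 1 = μ • 1 ∧ 1 ᵥ* A = μ • 1 := by
  simp [IsSemiMagic, funext_iff, mulVec, vecMul, dotProduct]

/-- bisymmetric permutation matrices transform magic squares into magic squares. -/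
theorem bisym_perm_magic {n : ℕ} (A P : Matrix (Fin n) (Fin n) ℝ) (μ : ℝ)
    (hA : IsMagic A μ) (hP : IsPermMat P) (hPb : IsBisym P) :
    IsMagic (P * A * P) μ := by
  obtain ⟨hrow, hcol, hdiag, hanti⟩ := hA
  obtain ⟨hsymm, hpersymm⟩ := hPb
  have hsq : P * P = 1 := by
    have h := hP.mul_transpose
    rwa [← hsymm] at h
  have hcomm : revMat n * P = P * revMat n := by
    rwa [transpose_mul, ← hsymm, revMat_transpose] at hpersymm
  have hright : P *ᵥ 1 = 1 := hP.mulVec_one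
  have hleft : 1 ᵥ* P = 1 := by
    rw [hsymm, vecMul_transpose, hright]
  obtain ⟨hAr, hAl⟩ := isSemiMagic_iff.1 ⟨hrow, hcol⟩
  have hsemi : IsSemiMagic (P * A * P) μ := by
    refine isSemiMagic_iff.2 ⟨?_, ?_⟩
    · rw [← mulVec_mulVec, hright, ← mulVec_mulVec, hAr, mulVec_smul, hright]
    · rw [← vecMul_vecMul, ← vecMul_vecMul, hleft, hAl, smul_vecMul, hleft]
  refine ⟨hsemi.1, hsemi.2, ?_, ?_⟩
  · rw [trace_mul_comm, ← Matrix.mul_assoc, hsq, Matrix.one_mul, hdiag]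
  · rw [← Matrix.mul_assoc, ← Matrix.mul_assoc, hcomm, trace_mul_comm, Matrix.mul_assoc P,
      ← Matrix.mul_assoc P, hsq, Matrix.one_mul, hanti]
end

section
/- If P is an n×n 90°-symmetric permutation matrix and A is an n×n real magic square with magic number μ, then P·A·P is a magic square with magic number μ. -/
open Matrix

theorem IsPermMat.sum_row {n : ℕ} {P : Matrix (Fin n) (Fin n) ℝ} (hP : IsPermMat P)
    (i : Fin n) : ∑ j, P i j = 1 := by
  obtain ⟨k, hk, huniq⟩ := hP.2.1 i
  rw [Finset.sum_eq_single k, hk]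
  · exact fun j _ hj => (hP.1 i j).resolve_right fun h => hj (huniq j h)
  · simp

theorem IsPermMat.transpose {n : ℕ} {P : Matrix (Fin n) (Fin n) ℝ} (hP : IsPermMat P) :
    IsPermMat Pᵀ :=
  ⟨fun i j => hP.1 j i, hP.2.2, hP.2.1⟩

/-- The square of a 90°-symmetric permutation matrix is the reverse matrix. -/
theorem IsRot90.mul_self {n : ℕ} {P : Matrix (Fin n) (Fin n) ℝ} (hPr : IsRot90 P)
    (hP : IsPermMat P) : P * P = revMat n := by
  have h : P = Pᵀ * revMat n := by
    have := congrArg Matrix.transpose hPr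
    rwa [Matrix.transpose_transpose, Matrix.transpose_mul, revMat_transpose] at this
  calc P * P = P * (Pᵀ * revMat n) := by rw [← h]
    _ = revMat n := by rw [← Matrix.mul_assoc, hP.mul_transpose, Matrix.one_mul]

theorem sum_row_mul {n : ℕ} {A B : Matrix (Fin n) (Fin n) ℝ} {a b : ℝ}
    (hA : ∀ i, ∑ j, A i j = a) (hB : ∀ i, ∑ j, B i j = b) (i : Fin n) :
    ∑ j, (A * B) i j = a * b := by
  simp only [Matrix.mul_apply]
  rw [Finset.sum_comm]
  simp only [← Finset.mul_sum, hB, ← Finset.sum_mul, hA]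

theorem sum_col_mul {n : ℕ} {A B : Matrix (Fin n) (Fin n) ℝ} {a b : ℝ}
    (hA : ∀ j, ∑ i, A i j = a) (hB : ∀ j, ∑ i, B i j = b) (j : Fin n) :
    ∑ i, (A * B) i j = a * b := by
  simp only [Matrix.mul_apply]
  rw [Finset.sum_comm]
  simp only [← Finset.sum_mul, hA, ← Finset.mul_sum, hB]

/-- 90°-symmetric permutation matrices transform magic squares into magic squares. -/
theorem rot90_perm_magic {n : ℕ} (A P : Matrix (Fin n) (Fin n) ℝ) (μ : ℝ)
    (hA : IsMagic A μ) (hP : IsPermMat P) (hPr : IsRot90 P) :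
    IsMagic (P * A * P) μ := by
  obtain ⟨hrow, hcol, htr, hanti⟩ := hA
  refine ⟨fun i => ?_, fun j => ?_, ?_, ?_⟩
  · simpa using sum_row_mul (sum_row_mul hP.sum_row hrow) hP.sum_row i
  · simpa using sum_col_mul (sum_col_mul hP.transpose.sum_row hcol) hP.transpose.sum_row j
  · rw [Matrix.trace_mul_comm, ← Matrix.mul_assoc, hPr.mul_self hP, hanti]
  · rw [← Matrix.mul_assoc, ← Matrix.mul_assoc, ← hPr, Matrix.trace_mul_comm,
      ← Matrix.mul_assoc, hP.mul_transpose, Matrix.one_mul, htr]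
end

section
/- If P and P′ are two MCPMs of the same even order n, then there exists a symmetric permutation matrix Q of order n such that P′ = Q·P·Q. -/
open Matrix

namespace Equiv.Perm

variable {α : Type*}

theorem mul_mul_zpow_of_sq_eq_one {σ τ : Perm α} (hσ : σ * σ = 1) (hτ : τ * τ = 1) (k : ℤ) :
    σ * (σ * τ) ^ k = (σ * τ) ^ (-k) * σ := by
  have hσi : σ⁻¹ = σ := inv_eq_of_mul_eq_one_left hσ
  have hτi : τ⁻¹ = τ := inv_eq_of_mul_eq_one_left hτ
  have h : SemiconjBy σ (σ * τ) (σ * τ)⁻¹ := by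
    simp only [SemiconjBy, _root_.mul_inv_rev, hσi, hτi]
    rw [← mul_assoc, hσ, mul_assoc, hσ, one_mul, mul_one]
  simpa only [SemiconjBy, _root_.inv_zpow'] using h.zpow_right k

/-- The reflections in the dihedral group generated by two fixed-point-free involutions are
fixed-point-free. -/
theorem apply_zpow_ne_of_fixedPointFree {σ τ : Perm α} (hσ : σ * σ = 1) (hτ : τ * τ = 1)
    (hσf : ∀ x, σ x ≠ x) (hτf : ∀ x, τ x ≠ x) (k : ℤ) (x : α) :
    σ (((σ * τ) ^ k) x) ≠ x := by
  intro h
  rw [← mul_apply] at h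
  obtain ⟨m, rfl | rfl⟩ := Int.even_or_odd' k
  · rw [two_mul, _root_.zpow_add, ← mul_assoc, mul_mul_zpow_of_sq_eq_one hσ hτ,
      _root_.zpow_neg, mul_assoc, mul_apply, inv_eq_iff_eq, mul_apply] at h
    exact hσf _ h
  · rw [show 2 * m + 1 = m + (1 + m) by ring, _root_.zpow_add, ← mul_assoc,
      mul_mul_zpow_of_sq_eq_one hσ hτ, _root_.zpow_neg, mul_assoc, mul_apply, inv_eq_iff_eq,
      _root_.zpow_add, zpow_one, ← mul_assoc, ← mul_assoc, hσ, one_mul, mul_apply] at h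
    exact hτf _ h

theorem eq_zpow_or_eq_mul_zpow_of_mem_closure {σ τ : Perm α} (hσ : σ * σ = 1) (hτ : τ * τ = 1)
    {g : Perm α} (hg : g ∈ Subgroup.closure {σ, τ}) :
    ∃ k : ℤ, g = (σ * τ) ^ k ∨ g = σ * (σ * τ) ^ k := by
  have hσi : σ⁻¹ = σ := inv_eq_of_mul_eq_one_left hσ
  have hτi : τ⁻¹ = τ := inv_eq_of_mul_eq_one_left hτ
  have hmul : ∀ x ∈ ({σ, τ} : Set (Perm α)), ∀ y,
      (∃ k : ℤ, y = (σ * τ) ^ k ∨ y = σ * (σ * τ) ^ k) →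
        ∃ k : ℤ, x * y = (σ * τ) ^ k ∨ x * y = σ * (σ * τ) ^ k := by
    rintro x (rfl | rfl) y ⟨k, rfl | rfl⟩
    · exact ⟨k, Or.inr rfl⟩
    · exact ⟨k, Or.inl (by rw [← mul_assoc, hσ, one_mul])⟩
    · refine ⟨1 + k, Or.inr ?_⟩
      rw [_root_.zpow_add, zpow_one, ← mul_assoc, ← mul_assoc, hσ, one_mul]
    · refine ⟨-1 + k, Or.inl ?_⟩
      rw [_root_.zpow_add, _root_.zpow_neg_one, _root_.mul_inv_rev, hσi, hτi, mul_assoc]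
  induction hg using Subgroup.closure_induction_left with
  | one => exact ⟨0, Or.inl (zpow_zero _).symm⟩
  | mul_left x hx y _ ih => exact hmul x hx y ih
  | inv_mul_cancel x hx y _ ih =>
    have hxi : x⁻¹ = x := by
      rcases hx with rfl | rfl
      · exact hσi
      · exact hτi
    rw [hxi]
    exact hmul x hx y ih

/-- A choice of base point in each orbit of the dihedral group generated by two involutions. -/
theorem exists_basePoint {σ τ : Perm α} (hσ : σ * σ = 1) (hτ : τ * τ = 1) :
    ∃ r : α → α, (∀ x, ∃ k : ℤ, x = ((σ * τ) ^ k) (r x) ∨ x = σ (((σ * τ) ^ k) (r x))) ∧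
      (∀ x, r (σ x) = r x) ∧ ∀ (k : ℤ) x, r (((σ * τ) ^ k) x) = r x := by
  let s : Setoid α := MulAction.orbitRel (Subgroup.closure {σ, τ}) α
  have hσm : σ ∈ Subgroup.closure {σ, τ} := Subgroup.subset_closure (by simp)
  have hτm : τ ∈ Subgroup.closure {σ, τ} := Subgroup.subset_closure (by simp)
  have hr : ∀ g ∈ Subgroup.closure {σ, τ}, ∀ x,
      (Quotient.mk s (g x)).out = (Quotient.mk s x).out := fun g hg x =>
    congrArg Quotient.out (Quotient.sound (s := s) ⟨⟨g, hg⟩, rfl⟩)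
  refine ⟨fun x => (Quotient.mk s x).out, fun x => ?_, hr σ hσm,
    fun k => hr _ (zpow_mem (mul_mem hσm hτm) k)⟩
  obtain ⟨⟨g, hg⟩, hgx⟩ := Setoid.symm (Quotient.mk_out (s := s) x)
  change g (Quotient.mk s x).out = x at hgx
  obtain ⟨k, hk⟩ := eq_zpow_or_eq_mul_zpow_of_mem_closure hσ hτ hg
  refine ⟨k, hk.imp (fun h => ?_) (fun h => ?_)⟩
  · rw [← h, hgx]
  · rw [← mul_apply, ← h, hgx]

/-- Two fixed-point-free involutions are conjugate by an involution. -/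
theorem exists_involution_conj {σ τ : Perm α} (hσ : σ * σ = 1) (hτ : τ * τ = 1)
    (hσf : ∀ x, σ x ≠ x) (hτf : ∀ x, τ x ≠ x) :
    ∃ q : Perm α, q * q = 1 ∧ q * σ * q = τ := by
  obtain ⟨r, hr, hrσ, hrk⟩ := exists_basePoint hσ hτ
  have hσσ (x : α) : σ (σ x) = x := by rw [← mul_apply, hσ, one_apply]
  have hrr (x : α) : r (r x) = r x := by
    obtain ⟨k, h | h⟩ := hr x
    · conv_rhs => rw [h, hrk]
    · conv_rhs => rw [h, hrσ, hrk]
  have hneg {k l : ℤ} {a : α} (h : ((σ * τ) ^ k) a = ((σ * τ) ^ l) a) (m : ℤ) :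
      ((σ * τ) ^ (m - k)) a = ((σ * τ) ^ (m - l)) a := by
    have := congrArg ((σ * τ) ^ (m - k - l)) h
    rw [← mul_apply, ← mul_apply, ← _root_.zpow_add, ← _root_.zpow_add] at this
    rw [show m - k = m - k - l + l by ring, ← this]
    congr 2
    ring
  have hne (k l : ℤ) (a : α) : ((σ * τ) ^ k) a ≠ σ (((σ * τ) ^ l) a) := by
    intro h
    refine apply_zpow_ne_of_fixedPointFree hσ hτ hσf hτf (k + l) a ?_
    rw [← mul_apply σ, _root_.zpow_add, ← mul_assoc,
      mul_mul_zpow_of_sq_eq_one hσ hτ, _root_.zpow_neg, mul_assoc, mul_apply, inv_eq_iff_eq,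
      mul_apply, h]
  have hex (x : α) : ∃ y, ∃ k : ℤ, (x = ((σ * τ) ^ k) (r x) ∧ y = ((σ * τ) ^ (0 - k)) (r x)) ∨
      (x = σ (((σ * τ) ^ k) (r x)) ∧ y = σ (((σ * τ) ^ (1 - k)) (r x))) := by
    obtain ⟨k, h | h⟩ := hr x
    · exact ⟨_, k, Or.inl ⟨h, rfl⟩⟩
    · exact ⟨_, k, Or.inr ⟨h, rfl⟩⟩
  choose f hf using hex
  have hrot (k : ℤ) (x : α) : f (((σ * τ) ^ k) (r x)) = ((σ * τ) ^ (0 - k)) (r x) := by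
    obtain ⟨l, ⟨h, e⟩ | ⟨h, _⟩⟩ := hf (((σ * τ) ^ k) (r x))
    · rw [hrk, hrr] at h e
      rw [e, hneg h]
    · rw [hrk, hrr] at h
      exact absurd h (hne _ _ _)
  have hrefl (k : ℤ) (x : α) :
      f (σ (((σ * τ) ^ k) (r x))) = σ (((σ * τ) ^ (1 - k)) (r x)) := by
    obtain ⟨l, ⟨h, _⟩ | ⟨h, e⟩⟩ := hf (σ (((σ * τ) ^ k) (r x)))
    · rw [hrσ, hrk, hrr] at h
      exact absurd h.symm (hne _ _ _)
    · rw [hrσ, hrk, hrr] at h e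
      rw [e, hneg (σ.injective h)]
  have hff : Function.Involutive f := fun x => by
    obtain ⟨k, h | h⟩ := hr x
    · rw [h, hrot, hrot, sub_sub_cancel]
    · rw [h, hrefl, hrefl, sub_sub_cancel]
  have hτσ (x : α) : τ x = σ ((σ * τ) x) := by rw [mul_apply, hσσ]
  have hconj (x : α) : f (σ x) = τ (f x) := by
    obtain ⟨k, h | h⟩ := hr x
    · rw [h, hrefl, hrot, hτσ, ← mul_apply (σ * τ), ← _root_.zpow_one_add, zero_sub,
        sub_eq_add_neg]
    · rw [h, hrefl, hσσ, hrot, zero_sub, sub_eq_add_neg, _root_.zpow_one_add, mul_apply (σ * τ),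
        mul_apply σ, hσσ, ← mul_apply τ, hτ, one_apply]
  refine ⟨hff.toPerm, ext fun x => hff x, ext fun x => ?_⟩
  change f (σ (f x)) = τ x
  rw [hconj, hff]

end Equiv.Perm

theorem Matrix.exists_fixedPointFree_of_isMCPM {n : ℕ} (hn : Even n)
    {P : Matrix (Fin n) (Fin n) ℝ} (hP : IsMCPM P) :
    ∃ σ : Equiv.Perm (Fin n), σ * σ = 1 ∧ (∀ x, σ x ≠ x) ∧ P = σ.permMatrix ℝ := by
  obtain ⟨⟨h01, hrow, -⟩, hsymm, htr⟩ := hP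
  have htr : P.trace = 0 := htr.elim (·.2) fun h => absurd hn (Nat.not_even_iff_odd.2 h.1)
  choose f hf hf' using hrow
  have hs (i j : Fin n) : P i j = P j i := congrFun (congrFun hsymm i) j
  have hinv : Function.Involutive f := fun i => (hf' (f i) i ((hs _ _).trans (hf i))).symm
  have hdiag : ∀ i, P i i = 0 := by
    have := (Finset.sum_eq_zero_iff_of_nonneg (s := Finset.univ) (f := fun i => P i i)
      fun i _ => by rcases h01 i i with h | h <;> simp [h]).1 htr
    exact fun i => this i (Finset.mem_univ i)
  refine ⟨hinv.toPerm, Equiv.ext hinv, fun i hi => ?_, ?_⟩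
  · have h := hf i
    rw [show f i = i from hi, hdiag] at h
    exact zero_ne_one h
  · ext i j
    rw [Equiv.Perm.permMatrix, PEquiv.toMatrix_apply]
    by_cases h : f i = j
    · simp [← h, hf]
    · have : P i j = 0 := (h01 i j).resolve_right fun h1 => h (hf' i j h1).symm
      simp [h, this]

theorem Matrix.isPermMat_permMatrix {n : ℕ} (σ : Equiv.Perm (Fin n)) :
    IsPermMat (σ.permMatrix ℝ) := by
  have h (i j : Fin n) : σ.permMatrix ℝ i j = if σ i = j then 1 else 0 := by
    simp [Equiv.Perm.permMatrix, PEquiv.toMatrix_apply]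
  refine ⟨fun i j => ?_, fun i => ⟨σ i, ?_⟩, fun j => ⟨σ.symm j, ?_⟩⟩
  · rw [h]
    split_ifs <;> simp
  · simp [eq_comm]
  · simp [Equiv.eq_symm_apply]

/-- any two MCPMs of the same even order are conjugate by a symmetric
permutation matrix. -/
theorem MCPM_conjugate {n : ℕ} (hn : Even n) (P P' : Matrix (Fin n) (Fin n) ℝ)
    (hP : IsMCPM P) (hP' : IsMCPM P') :
    ∃ Q : Matrix (Fin n) (Fin n) ℝ, IsPermMat Q ∧ Q = Qᵀ ∧ P' = Q * P * Q := by
  obtain ⟨σ, hσ, hσf, rfl⟩ := Matrix.exists_fixedPointFree_of_isMCPM hn hP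
  obtain ⟨τ, hτ, hτf, rfl⟩ := Matrix.exists_fixedPointFree_of_isMCPM hn hP'
  obtain ⟨q, hq, hconj⟩ := Equiv.Perm.exists_involution_conj hσ hτ hσf hτf
  refine ⟨q.permMatrix ℝ, Matrix.isPermMat_permMatrix q, ?_, ?_⟩
  · rw [Matrix.transpose_permMatrix, inv_eq_of_mul_eq_one_left hq]
  · rw [← Matrix.permMatrix_mul, ← Matrix.permMatrix_mul, ← mul_assoc, hconj]
end

section
/- Let A be an n×n magic square with magic number μ that is of type A_P for an MCPM P. If λ ≠ μ and x ∈ ℝⁿ is a nonzero vector with A·x = λ·x, then A·(P·x) = −λ·(P·x) and P·x ≠ 0; that is, −λ is also an eigenvalue of A, with eigenvector P·x. -/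
open Matrix

/-- A symmetric permutation matrix is an involution. -/
theorem IsPermMat.mul_self_of_symm {n : ℕ} {P : Matrix (Fin n) (Fin n) ℝ}
    (hP : IsPermMat P) (hsymm : P = Pᵀ) : P * P = 1 := by
  obtain ⟨h01, hrow, hcol⟩ := hP
  ext i k
  obtain ⟨j, hj, hj_unique⟩ := hrow i
  have hzero : ∀ m, m ≠ j → P i m = 0 := fun m hm =>
    (h01 i m).resolve_right fun h => hm (hj_unique m h)
  have hswap : P j k = P k j := congrFun (congrFun hsymm j) k
  rw [Matrix.mul_apply, Finset.sum_eq_single j (fun m _ hm => by rw [hzero m hm, zero_mul])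
    (fun h => absurd (Finset.mem_univ j) h), hj, one_mul, hswap]
  by_cases hik : i = k
  · subst hik
    rw [hj, Matrix.one_apply_eq]
  · rw [Matrix.one_apply_ne hik]
    exact (h01 k j).resolve_right fun h => hik ((hcol j).unique hj h)

/-- If all columns of `A` sum to `μ`, then an eigenvector of `A` for an eigenvalue other than `μ`
has entries summing to zero. -/
theorem sum_eq_zero_of_mulVec_eq_smul {n : ℕ} {A : Matrix (Fin n) (Fin n) ℝ} {μ l : ℝ}
    (hcol : ∀ j, ∑ i, A i j = μ) (hl : l ≠ μ) {x : Fin n → ℝ} (heig : A *ᵥ x = l • x) :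
    ∑ i, x i = 0 := by
  have hsum : l * ∑ i, x i = μ * ∑ i, x i := by
    calc l * ∑ i, x i = ∑ i, (A *ᵥ x) i := by
          rw [heig, Finset.mul_sum]
          rfl
      _ = ∑ j, ∑ i, A i j * x j := by
          simp only [Matrix.mulVec, dotProduct]
          exact Finset.sum_comm
      _ = μ * ∑ i, x i := by simp only [← Finset.sum_mul, hcol, ← Finset.mul_sum]
  exact (mul_eq_mul_right_iff.mp hsum).resolve_left hl

/-- eigenvalues of a type `A_P` magic square other than `μ` come in `±λ`
pairs, with eigenvector `P·x` for `-λ`. -/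
theorem typeA_eigen_pairs {n : ℕ} (A P : Matrix (Fin n) (Fin n) ℝ) (μ l : ℝ)
    (hA : IsMagic A μ) (hP : IsMCPM P)
    (htype : A + P * A * P = (2 * μ / (n : ℝ)) • allOnes n)
    (x : Fin n → ℝ) (hx : x ≠ 0) (hl : l ≠ μ) (heig : A *ᵥ x = l • x) :
    A *ᵥ (P *ᵥ x) = (-l) • (P *ᵥ x) ∧ P *ᵥ x ≠ 0 := by
  have hPP : P * P = 1 := hP.1.mul_self_of_symm hP.2.1
  have hE : allOnes n *ᵥ x = 0 := by
    ext i
    simpa [allOnes, Matrix.mulVec, dotProduct] using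
      sum_eq_zero_of_mulVec_eq_smul hA.2.1 hl heig
  have hPPv : ∀ v : Fin n → ℝ, P *ᵥ (P *ᵥ v) = v := fun v => by
    rw [Matrix.mulVec_mulVec, hPP, Matrix.one_mulVec]
  have hadd : l • x + P *ᵥ (A *ᵥ (P *ᵥ x)) = 0 := by
    have h := congrArg (· *ᵥ x) htype
    simpa only [Matrix.add_mulVec, Matrix.smul_mulVec, hE, smul_zero, heig,
      ← Matrix.mulVec_mulVec] using h
  refine ⟨?_, fun h => hx ?_⟩
  · rw [← hPPv (A *ᵥ (P *ᵥ x)), eq_neg_of_add_eq_zero_right hadd, ← neg_smul, Matrix.mulVec_smul]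
  · rw [← hPPv x, h, Matrix.mulVec_zero]
end

section
/- If A is a magic square of even order n with magic number μ that is of type A (i.e., A + P·A·P = (2μ/n)·E for some MCPM P), then det(A) = 0. -/
open Matrix

theorem IsPermMat.exists_perm {n : ℕ} {P : Matrix (Fin n) (Fin n) ℝ} (hP : IsPermMat P) :
    ∃ σ : Fin n → Fin n, Function.Injective σ ∧ ∀ i j, P i j = if j = σ i then 1 else 0 := by
  obtain ⟨h01, hrow, hcol⟩ := hP
  choose σ hσ hu using hrow
  refine ⟨σ, fun i k hik => ?_, fun i j => ?_⟩
  · exact (hcol (σ i)).unique (hσ i) (by rw [hik]; exact hσ k)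
  · split_ifs with h
    · rw [h]; exact hσ i
    · exact (h01 i j).resolve_right fun h1 => h (hu i j h1)

theorem IsPermMat.mul_allOnes {n : ℕ} {P : Matrix (Fin n) (Fin n) ℝ} (hP : IsPermMat P) :
    P * allOnes n = allOnes n := by
  obtain ⟨σ, -, hσ⟩ := hP.exists_perm
  ext i k
  simp [Matrix.mul_apply, hσ, allOnes]

theorem IsMagic.mul_allOnes {n : ℕ} {A : Matrix (Fin n) (Fin n) ℝ} {μ : ℝ} (hA : IsMagic A μ) :
    A * allOnes n = μ • allOnes n := by
  ext i k
  simp [Matrix.mul_apply, allOnes, hA.1 i]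

/-- a type A magic square of even order is singular. -/
theorem typeA_even_singular {n : ℕ} (hn : 0 < n) (hEven : Even n)
    (A : Matrix (Fin n) (Fin n) ℝ) (μ : ℝ) (hA : IsMagic A μ)
    (htype : ∃ P : Matrix (Fin n) (Fin n) ℝ,
      IsMCPM P ∧ A + P * A * P = (2 * μ / (n : ℝ)) • allOnes n) :
    A.det = 0 := by
  obtain ⟨P, ⟨hP, hsymm, htr⟩, hAP⟩ := htype
  have htrP : P.trace = 0 := by
    rcases htr with h | h
    · exact h.2
    · exact absurd hEven (Nat.not_even_iff_odd.mpr h.1)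
  have hPP : P * P = 1 := by
    have h := hP.mul_transpose
    rwa [← hsymm] at h
  have hn0 : (n : ℝ) ≠ 0 := Nat.cast_ne_zero.mpr hn.ne'
  have htrE : (allOnes n).trace = n := by simp [Matrix.trace, allOnes]
  by_contra hdet
  have hinv : A⁻¹ * A = 1 := Matrix.nonsing_inv_mul A (isUnit_iff_ne_zero.mpr hdet)
  have hE : allOnes n = μ • (A⁻¹ * allOnes n) := by
    rw [← Matrix.mul_smul, ← hA.mul_allOnes, ← Matrix.mul_assoc, hinv, Matrix.one_mul]
  have hanti : P * A + A * P = (2 * μ / (n : ℝ)) • allOnes n := by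
    have h := congrArg (P * ·) hAP
    simpa only [Matrix.mul_add, ← Matrix.mul_assoc, hPP, Matrix.one_mul, Matrix.mul_smul,
      hP.mul_allOnes] using h
  have hconj : A⁻¹ * P * A + P = (2 / (n : ℝ)) • allOnes n := by
    have h := congrArg (A⁻¹ * ·) hanti
    simp only [Matrix.mul_add, ← Matrix.mul_assoc, hinv, Matrix.one_mul, Matrix.mul_smul] at h
    rw [h, mul_div_right_comm, mul_smul, ← hE]
  have htrace := congrArg Matrix.trace hconj
  rw [Matrix.trace_add, Matrix.mul_assoc, Matrix.trace_mul_comm, Matrix.mul_assoc,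
    Matrix.mul_nonsing_inv A (isUnit_iff_ne_zero.mpr hdet), Matrix.mul_one, htrP,
    Matrix.trace_smul, htrE, smul_eq_mul, div_mul_cancel₀ _ hn0] at htrace
  norm_num at htrace
end
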